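/- Let λ₁, λ₂ be coprime positive integers with λ₁ ≡ λ₂ - 1 (mod 3) and S = {0, λ₁, λ₁+λ₂}. Then every S-packing set A ⊆ ℤ has upper density at most ⌊(1/3)(2λ₁+λ₂)⌋/(2λ₁+λ₂). -/

import Mathlib

open Filter Set

/-- The translateSet `S + t` of a set of integers. -/
def translateSet (S : Set ℤ) (t : ℤ) : Set ℤ := (· + t) '' S

/-- Upper density of a set of integers. -/
noncomputable def upperDensity (A : Set ℤ) : ℝ :=
  Filter.limsup (fun n : ℕ => ((A ∩ Set.Icc (-(n : ℤ)) (n : ℤ)).ncard : ℝ) / (2 * n + 1)) Filter.atTop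

/-- Lower density of a set of integers. -/
noncomputable def lowerDensity (A : Set ℤ) : ℝ :=
  Filter.liminf (fun n : ℕ => ((A ∩ Set.Icc (-(n : ℤ)) (n : ℤ)).ncard : ℝ) / (2 * n + 1)) Filter.atTop

/-- `A` is `S`-covering: every integer lies in some translateSet `S + a`, `a ∈ A`. -/
def SCovering (S A : Set ℤ) : Prop := ∀ t : ℤ, ∃ a ∈ A, t ∈ translateSet S a

/-- `A` is `S`-blocking: `A` meets every translateSet of `S`. -/
def SBlocking (S A : Set ℤ) : Prop := ∀ t : ℤ, (A ∩ translateSet S t).Nonempty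

/-- `A` is `S`-free: `A` contains no translateSet of `S`. -/
def SFree (S A : Set ℤ) : Prop := ∀ t : ℤ, ¬ translateSet S t ⊆ A

/-- `A` is `S`-packing: distinct translates `S + a₁`, `S + a₂` with `a₁, a₂ ∈ A` are disjoint. -/
def SPacking (S A : Set ℤ) : Prop :=
  ∀ a₁ ∈ A, ∀ a₂ ∈ A, a₁ ≠ a₂ → Disjoint (translateSet S a₁) (translateSet S a₂)

/-- Maximum packing density of `S`. -/
noncomputable def dP (S : Set ℤ) : ℝ := sSup (upperDensity '' {A | SPacking S A})

/-- Minimum covering density of `S`. -/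
noncomputable def dC (S : Set ℤ) : ℝ := sInf (lowerDensity '' {A | SCovering S A})

/-- Minimum blocking density of `S`. -/
noncomputable def dB (S : Set ℤ) : ℝ := sInf (lowerDensity '' {A | SBlocking S A})

/-- `d_f(S)`: supremum of upper densities of `S`-free sets. -/
noncomputable def dF (S : Set ℤ) : ℝ := sSup (upperDensity '' {A | SFree S A})

/-- `d_f(S, -S)`: supremum of upper densities of sets free of translates of both `S` and `-S`. -/
noncomputable def dF2 (S : Set ℤ) : ℝ := sSup (upperDensity '' {A | SFree S A ∧ SFree (-S) A})

/-- Sums over consecutive integer intervals add up. -/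
theorem sum_Ico_int_consecutive (f : ℤ → ℤ) {a b c : ℤ} (hab : a ≤ b) (hbc : b ≤ c) :
    ∑ x ∈ Finset.Ico a b, f x + ∑ x ∈ Finset.Ico b c, f x = ∑ x ∈ Finset.Ico a c, f x := by
  rw [← Finset.Ico_union_Ico_eq_Ico hab hbc,
    Finset.sum_union (Finset.Ico_disjoint_Ico_consecutive a b c)]

theorem sum_Ico_int_shift (f : ℤ → ℤ) (a b c : ℤ) :
    ∑ x ∈ Finset.Ico a b, f (x + c) = ∑ x ∈ Finset.Ico (a + c) (b + c), f x :=
  Finset.sum_Ico_add' f a b c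

/-- `1` if the triangle `{x, x + l1, x + l1 + l2}` misses the set with indicator `f`, and `0` if it
contains exactly one point of it. -/
def triangleDefect (f : ℤ → ℤ) (l1 l2 x : ℤ) : ℤ := 1 - f x - f (x + l1) - f (x + (l1 + l2))

/-- `f` is the indicator of a set of integers without differences `l1`, `l2`, `l1 + l2`. -/
structure AvoidsTriangle (f : ℤ → ℤ) (l1 l2 : ℤ) : Prop where
  zero_or_one : ∀ x, f x = 0 ∨ f x = 1
  left : ∀ x, f x + f (x + l1) ≤ 1
  right : ∀ x, f x + f (x + l2) ≤ 1
  sum : ∀ x, f x + f (x + (l1 + l2)) ≤ 1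

namespace AvoidsTriangle

variable {f : ℤ → ℤ} {l1 l2 : ℤ}

theorem triangleDefect_nonneg (hf : AvoidsTriangle f l1 l2) (x : ℤ) :
    0 ≤ triangleDefect f l1 l2 x := by
  have h1 := hf.left x
  have h2 := hf.sum x
  have h3 := hf.right (x + l1)
  rw [add_assoc] at h3
  unfold triangleDefect
  rcases hf.zero_or_one x with h | h <;> rcases hf.zero_or_one (x + l1) with h' | h' <;>
    rcases hf.zero_or_one (x + (l1 + l2)) with h'' | h'' <;> omega

/-- Two points at distance `2 * l1` force an empty triangle. -/
theorem le_triangleDefect (hf : AvoidsTriangle f l1 l2) (x : ℤ) :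
    f x + f (x + l1) + f (x + 2 * l1) - 1 ≤ triangleDefect f l1 l2 (x - l2) := by
  have h0 := hf.triangleDefect_nonneg (x - l2)
  have h1 := hf.left x
  have h2 := hf.left (x + l1)
  have h3 := hf.right (x - l2)
  have h4 := hf.sum (x - l2 + l1)
  rw [show x + l1 + l1 = x + 2 * l1 by ring] at h2
  rw [show x - l2 + l2 = x by ring] at h3
  rw [show x - l2 + l1 + (l1 + l2) = x + 2 * l1 by ring] at h4
  unfold triangleDefect at h0 ⊢
  rw [show x - l2 + (l1 + l2) = x + l1 by ring] at h0 ⊢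
  have := hf.zero_or_one (x - l2)
  have := hf.zero_or_one (x - l2 + l1)
  have := hf.zero_or_one x
  have := hf.zero_or_one (x + l1)
  have := hf.zero_or_one (x + 2 * l1)
  omega

theorem one_le_line (hf : AvoidsTriangle f l1 l2) {x : ℤ} (h : triangleDefect f l1 l2 x = 0)
    (h' : triangleDefect f l1 l2 (x + l1) = 0) : 1 ≤ f x + f (x + l1) + f (x + 2 * l1) := by
  have h1 := hf.left (x + (l1 + l2))
  unfold triangleDefect at h h'
  rw [show x + (l1 + l2) + l1 = x + l1 + (l1 + l2) by ring] at h1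
  rw [show x + l1 + l1 = x + 2 * l1 by ring] at h'
  have := hf.zero_or_one x
  have := hf.zero_or_one (x + l1)
  have := hf.zero_or_one (x + 2 * l1)
  omega

/-- The opposite triangle `{y, y + l2, y + l1 + l2}`, `y = x + l1`, is met exactly once as soon as
four nearby triangles are. -/
theorem opposite_triangle (hf : AvoidsTriangle f l1 l2) {x : ℤ}
    (h0 : triangleDefect f l1 l2 x = 0) (h2 : triangleDefect f l1 l2 (x + (l1 + l2)) = 0)
    (h3 : triangleDefect f l1 l2 (x + l2) = 0) :
    f (x + l1) + f (x + l1 + l2) + f (x + l1 + (l1 + l2)) = 1 := by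
  have a1 := hf.right (x + l1)
  have a2 := hf.left (x + l1 + l2)
  have a3 := hf.sum (x + l1)
  have a4 := hf.right x
  have a5 := hf.left (x + (l1 + l2) + l2)
  unfold triangleDefect at h0 h2 h3
  rw [show x + l1 + l2 + l1 = x + l1 + (l1 + l2) by ring] at a2
  rw [show x + (l1 + l2) = x + l1 + l2 by ring] at h0 h2
  rw [show x + l1 + l2 + l1 = x + l1 + (l1 + l2) by ring] at h2
  rw [show x + l2 + l1 = x + l1 + l2 by ring,
    show x + l2 + (l1 + l2) = x + l1 + l2 + l2 by ring] at h3
  rw [show x + (l1 + l2) + l2 = x + l1 + l2 + l2 by ring,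
    show x + l1 + l2 + l2 + l1 = x + l1 + l2 + (l1 + l2) by ring] at a5
  have := hf.zero_or_one x
  have := hf.zero_or_one (x + l1)
  have := hf.zero_or_one (x + l1 + l2)
  have := hf.zero_or_one (x + l1 + (l1 + l2))
  omega

/-- An interval of length `2 * l1 + l2` without empty triangles is preceded by two of them. -/
theorem two_le_sum_triangleDefect (hf : AvoidsTriangle f l1 l2) (h1 : 0 < l1) (h2 : 0 < l2)
    (hmod : l1 % 3 = (l2 - 1) % 3) (a : ℤ)
    (ha : ∀ x, a ≤ x → x < a + (2 * l1 + l2) → triangleDefect f l1 l2 x = 0) :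
    2 ≤ ∑ x ∈ Finset.Ico (a - (l2 - l1)) a, triangleDefect f l1 l2 x := by
  set g := triangleDefect f l1 l2 with hg
  have hup : ∑ x ∈ Finset.Ico (a + l1) (a + 2 * l1), (f x + f (x + l1) + f (x + (l1 + l2))) =
      l1 := by
    rw [Finset.sum_congr rfl (g := fun _ => (1 : ℤ))]
    · simp; omega
    · intro x hx
      rw [Finset.mem_Ico] at hx
      have := ha x (by omega) (by omega)
      simp only [hg, triangleDefect] at this
      omega
  have hdown : ∑ x ∈ Finset.Ico (a + l1) (a + 2 * l1), (f x + f (x + l2) + f (x + (l1 + l2))) =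
      l1 := by
    rw [Finset.sum_congr rfl (g := fun _ => (1 : ℤ))]
    · simp; omega
    · intro x hx
      rw [Finset.mem_Ico] at hx
      have := hf.opposite_triangle (x := x - l1) (ha _ (by omega) (by omega))
        (ha _ (by omega) (by omega)) (ha _ (by omega) (by omega))
      simpa using this
  set B : ℤ → ℤ := fun x => f x + f (x + l1) + f (x + 2 * l1) - 1 with hB
  have hline : ∑ x ∈ Finset.Ico (a + l1) (a + l1 + l2), (f x + f (x + l1) + f (x + 2 * l1)) =
      l2 + ∑ x ∈ Finset.Ico (a + l1) (a + l1 + l2), B x := by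
    simp only [hB, Finset.sum_sub_distrib]
    simp [h2.le]
  have hB0 : 0 ≤ ∑ x ∈ Finset.Ico (a + l1) (a + l1 + l2), B x := by
    refine Finset.sum_nonneg fun x hx => ?_
    rw [Finset.mem_Ico] at hx
    have := hf.one_le_line (x := x) (ha _ (by omega) (by omega)) (ha _ (by omega) (by omega))
    simp only [hB]
    omega
  have hBg : ∑ x ∈ Finset.Ico (a + l1) (a + l1 + l2), B x ≤
      ∑ x ∈ Finset.Ico (a + l1 - l2) (a + l1), g x := by
    have := sum_Ico_int_shift g (a + l1) (a + l1 + l2) (-l2)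
    rw [show a + l1 + l2 + -l2 = a + l1 by ring] at this
    rw [sub_eq_add_neg, ← this]
    exact Finset.sum_le_sum fun x _ => hf.le_triangleDefect x
  simp only [Finset.sum_add_distrib, sum_Ico_int_shift] at hup hdown hline
  have hw1 := sum_Ico_int_consecutive f (a := a + l1) (b := a + l1 + l2) (c := a + 2 * l1 + l2)
    (by omega) (by omega)
  have hw2 := sum_Ico_int_consecutive f (a := a + l1) (b := a + 2 * l1 + l2)
    (c := a + 3 * l1 + l2) (by omega) (by omega)
  have hw3 := sum_Ico_int_consecutive f (a := a + l1) (b := a + 2 * l1) (c := a + 2 * l1 + l2)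
    (by omega) (by omega)
  have hw4 := sum_Ico_int_consecutive f (a := a + l1) (b := a + 2 * l1) (c := a + 3 * l1)
    (by omega) (by omega)
  have hw5 := sum_Ico_int_consecutive f (a := a + l1) (b := a + 3 * l1) (c := a + 3 * l1 + l2)
    (by omega) (by omega)
  ring_nf at hup hdown hline hw1 hw2 hw3 hw4 hw5 hB0 hBg ⊢
  have hb : 2 ≤ ∑ x ∈ Finset.Ico (a + l1) (a + l1 + l2), B x := by omega
  rcases le_or_gt l1 l2 with h | h
  · have hs := sum_Ico_int_consecutive g (a := a + l1 - l2) (b := a) (c := a + l1)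
      (by omega) (by omega)
    rw [Finset.sum_eq_zero (s := Finset.Ico a (a + l1))] at hs
    · omega
    · intro x hx
      rw [Finset.mem_Ico] at hx
      exact ha x (by omega) (by omega)
  · rw [Finset.sum_eq_zero (s := Finset.Ico (a + l1 - l2) (a + l1))] at hBg
    · omega
    · intro x hx
      rw [Finset.mem_Ico] at hx
      exact ha x (by omega) (by omega)

/-- Empty triangles have lower density at least `1 / (2 * l1 + l2)`, uniformly on intervals. -/
theorem le_mul_sum_triangleDefect (hf : AvoidsTriangle f l1 l2) (h1 : 0 < l1) (h2 : 0 < l2)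
    (hmod : l1 % 3 = (l2 - 1) % 3) (N : ℕ) (e : ℤ) :
    N - 2 * (2 * l1 + l2) ≤
      (2 * l1 + l2) * ∑ x ∈ Finset.Ico (e - N) e, triangleDefect f l1 l2 x := by
  induction N using Nat.strong_induction_on generalizing e with
  | _ N ih =>
    set m := 2 * l1 + l2 with hm
    set g := triangleDefect f l1 l2 with hg
    have hg0 : ∀ x, 0 ≤ g x := hf.triangleDefect_nonneg
    have hs0 : ∀ a b, 0 ≤ ∑ x ∈ Finset.Ico a b, g x := fun a b =>
      Finset.sum_nonneg fun x _ => hg0 x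
    have peel : ∀ L c : ℤ, 0 < L → L ≤ N → L ≤ m * c → c ≤ ∑ x ∈ Finset.Ico (e - L) e, g x →
        N - 2 * m ≤ m * ∑ x ∈ Finset.Ico (e - N) e, g x := by
      intro L c hL hLN hLc hc
      have h := ih (N - L).toNat (by omega) (e - L)
      rw [Int.toNat_of_nonneg (by omega), show e - L - (N - L) = e - N by ring] at h
      rw [← sum_Ico_int_consecutive g (a := e - N) (b := e - L) (c := e) (by omega) (by omega)]
      nlinarith
    rcases le_or_gt (N : ℤ) (2 * m) with hN | hN
    · have := mul_nonneg (show 0 ≤ m by omega) (hs0 (e - N) e)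
      omega
    · by_cases hz : ∑ x ∈ Finset.Ico (e - m) e, g x = 0
      · have hz' := (Finset.sum_eq_zero_iff_of_nonneg fun x _ => hg0 x).1 hz
        have h := hf.two_le_sum_triangleDefect h1 h2 hmod (e - m) fun x hx hx' =>
          hz' x (Finset.mem_Ico.2 ⟨hx, by omega⟩)
        have hlt : l1 < l2 := by
          by_contra hle
          rw [Finset.Ico_eq_empty (by omega)] at h
          simp at h
        refine peel (m + (l2 - l1)) 2 (by omega) (by omega) (by omega) ?_
        rw [← sum_Ico_int_consecutive g (b := e - m) (by omega) (by omega), hz,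
          show e - (m + (l2 - l1)) = e - m - (l2 - l1) by ring]
        simpa using h
      · have := hs0 (e - m) e
        exact peel m 1 (by omega) (by omega) (by omega) (by omega)

/-- An interval contains about a fraction `(1 - 1 / (2 * l1 + l2)) / 3` of points at most. -/
theorem mul_sum_le (hf : AvoidsTriangle f l1 l2) (h1 : 0 < l1) (h2 : 0 < l2)
    (hmod : l1 % 3 = (l2 - 1) % 3) (n : ℕ) :
    3 * (2 * l1 + l2) * ∑ x ∈ Finset.Icc (-(n : ℤ)) n, f x ≤
      (2 * l1 + l2 - 1) * (2 * n + 1) +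
        ((2 * l1 + l2 - 1) * (l1 + l2) + 2 * (2 * l1 + l2)) := by
  have hf0 : ∀ x, 0 ≤ f x := fun x => by rcases hf.zero_or_one x with h | h <;> omega
  have hD := hf.le_mul_sum_triangleDefect h1 h2 hmod (2 * n + 1 + (l1 + l2)).toNat (n + 1)
  rw [Int.toNat_of_nonneg (by omega),
    show (n : ℤ) + 1 - (2 * n + 1 + (l1 + l2)) = -n - (l1 + l2) by ring] at hD
  have hsum : ∑ x ∈ Finset.Ico (-(n : ℤ) - (l1 + l2)) (n + 1), triangleDefect f l1 l2 x ≤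
      (2 * n + 1 + (l1 + l2)) - 3 * ∑ x ∈ Finset.Icc (-(n : ℤ)) n, f x := by
    have hle : ∀ c, 0 ≤ c → c ≤ l1 + l2 → ∑ x ∈ Finset.Icc (-(n : ℤ)) n, f x ≤
        ∑ x ∈ Finset.Ico (-(n : ℤ) - (l1 + l2)) (n + 1), f (x + c) := by
      intro c hc hc'
      rw [sum_Ico_int_shift]
      refine Finset.sum_le_sum_of_subset_of_nonneg (fun x hx => ?_) fun x _ _ => hf0 x
      rw [Finset.mem_Icc] at hx
      rw [Finset.mem_Ico]
      omega
    have e0 := hle 0 le_rfl (by omega)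
    have e1 := hle l1 h1.le (by omega)
    have e2 := hle (l1 + l2) (by omega) le_rfl
    simp only [triangleDefect, Finset.sum_sub_distrib]
    simp only [add_zero] at e0
    simp only [Finset.sum_const, Int.card_Ico, nsmul_eq_mul, mul_one]
    rw [Int.toNat_of_nonneg (by omega)]
    omega
  have hm : 0 ≤ 2 * l1 + l2 := by omega
  nlinarith [mul_le_mul_of_nonneg_left hsum hm]

end AvoidsTriangle

open Classical in
theorem SPacking.avoidsTriangle {l1 l2 : ℤ} (h1 : 0 < l1) (h2 : 0 < l2) {A : Set ℤ}
    (hA : SPacking ({0, l1, l1 + l2} : Set ℤ) A) :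
    AvoidsTriangle (fun x => if x ∈ A then 1 else 0) l1 l2 := by
  have key : ∀ x d s t : ℤ, 0 < d → s ∈ ({0, l1, l1 + l2} : Set ℤ) →
      t ∈ ({0, l1, l1 + l2} : Set ℤ) → s = t + d →
      (if x ∈ A then (1 : ℤ) else 0) + (if x + d ∈ A then 1 else 0) ≤ 1 := by
    intro x d s t hd hs ht hst
    split_ifs with hx hxd <;> try norm_num
    exact Set.disjoint_left.1 (hA x hx (x + d) hxd (by omega)) ⟨s, hs, rfl⟩
      ⟨t, ht, by simp only [hst]; ring⟩
  refine ⟨fun x => ?_, fun x => ?_, fun x => ?_, fun x => ?_⟩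
  · split_ifs <;> simp
  · exact key x l1 l1 0 h1 (by simp) (by simp) (by ring)
  · exact key x l2 (l1 + l2) l1 h2 (by simp) (by simp) (by ring)
  · exact key x (l1 + l2) (l1 + l2) 0 (by omega) (by simp) (by simp) (by ring)

/-- A linear bound on the counting function bounds the upper density by its slope. -/
theorem upperDensity_le_of_ncard_le {A : Set ℤ} {α C : ℝ}
    (h : ∀ n : ℕ, ((A ∩ Set.Icc (-(n : ℤ)) (n : ℤ)).ncard : ℝ) ≤ α * (2 * n + 1) + C) :
    upperDensity A ≤ α := by
  have hlim : Tendsto (fun n : ℕ => α + C / (2 * (n : ℝ) + 1)) atTop (nhds α) := by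
    have : Tendsto (fun n : ℕ => 2 * (n : ℝ) + 1) atTop atTop :=
      tendsto_atTop_add_const_right _ _
        (tendsto_natCast_atTop_atTop.const_mul_atTop (by norm_num))
    simpa using tendsto_const_nhds.add (this.const_div_atTop C)
  rw [← hlim.limsup_eq]
  refine limsup_le_limsup (Eventually.of_forall fun n => ?_) ?_ hlim.isBoundedUnder_le
  · have hn : (0 : ℝ) < 2 * n + 1 := by positivity
    rw [div_le_iff₀ hn, add_mul, div_mul_cancel₀ _ hn.ne']
    exact h n
  · refine IsBoundedUnder.isCoboundedUnder_le ⟨0, ?_⟩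
    exact eventually_map.2 (Eventually.of_forall fun n => by positivity)

theorem stmt16 (l1 l2 : ℤ) (h1 : 0 < l1) (h2 : 0 < l2) (hco : Int.gcd l1 l2 = 1)
    (hmod : l1 % 3 = (l2 - 1) % 3) (A : Set ℤ)
    (hA : SPacking ({0, l1, l1 + l2} : Set ℤ) A) :
    upperDensity A ≤ (⌊(1 : ℝ) / 3 * (2 * l1 + l2)⌋ : ℝ) / (2 * l1 + l2) := by
  classical
  have hf := hA.avoidsTriangle h1 h2
  obtain ⟨k, hk⟩ : ∃ k : ℤ, 2 * l1 + l2 = 3 * k + 1 := ⟨(2 * l1 + l2) / 3, by omega⟩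
  have hkR : (2 * l1 + l2 : ℝ) = 3 * k + 1 := by exact_mod_cast hk
  have hfloor : ⌊(1 : ℝ) / 3 * (2 * l1 + l2)⌋ = k := by
    rw [Int.floor_eq_iff, hkR]
    constructor <;> linarith
  have hpos : (0 : ℝ) < 3 * k + 1 := by
    have : 0 < 3 * k + 1 := by omega
    exact_mod_cast this
  rw [hfloor, hkR]
  refine upperDensity_le_of_ncard_le
    (C := ((3 * k) * (l1 + l2) + 2 * (3 * k + 1)) / (3 * (3 * k + 1))) fun n => ?_
  have hcard : ((A ∩ Set.Icc (-(n : ℤ)) (n : ℤ)).ncard : ℤ) =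
      ∑ x ∈ Finset.Icc (-(n : ℤ)) n, if x ∈ A then 1 else 0 := by
    rw [Finset.sum_boole, ← Set.ncard_coe_finset]
    congr 2
    ext x
    simp only [Set.mem_inter_iff, Set.mem_Icc, Finset.coe_filter, Finset.mem_Icc,
      Set.mem_ofPred_eq]
    tauto
  have hb := hf.mul_sum_le h1 h2 hmod n
  rw [← hcard, hk] at hb
  have hbR : 3 * (3 * (k : ℝ) + 1) * ((A ∩ Set.Icc (-(n : ℤ)) (n : ℤ)).ncard : ℝ) ≤
      (3 * k + 1 - 1) * (2 * n + 1) + ((3 * k + 1 - 1) * (l1 + l2) + 2 * (3 * k + 1)) := by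
    exact_mod_cast hb
  rw [div_mul_eq_mul_div, div_add_div _ _ hpos.ne' (by positivity), le_div_iff₀ (by positivity)]
  nlinarith [mul_le_mul_of_nonneg_left hbR hpos.le]
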